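/- (Strong form of Theorem 2 established in its proof.) If the Frank–Wolfe algorithm is run for R ≥ 2 iterations, then there exists an iterate index r with ⌈(2/3)·(R+2)⌉ − 2 ≤ r ≤ R such that φ(w^(r)) ≤ (27/4)·C_f·(1 + δ)/(R+2); i.e., the surrogate duality gap cannot remain larger than this bound throughout the last third of the R iterations. -/

import Mathlib

open scoped RealInnerProductSpace BigOperators

noncomputable section

/-- The standard simplex `D = {w ∈ ℝ^K : wᵢ ≥ 0, Σᵢ wᵢ = 1}`. -/
def simplexD (K : ℕ) : Set (EuclideanSpace ℝ (Fin K)) :=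
  {w | (∀ i, 0 ≤ w i) ∧ ∑ i, w i = 1}

/-- The surrogate duality gap `φ(w) = max_{s ∈ D} ⟨w − s, ∇L(w)⟩`. -/
def dualGap {K : ℕ} (gradL : EuclideanSpace ℝ (Fin K) → EuclideanSpace ℝ (Fin K))
    (w : EuclideanSpace ℝ (Fin K)) : ℝ :=
  sSup ((fun s => ⟪w - s, gradL w⟫) '' simplexD K)

theorem fw_bdd {K : ℕ} (g : EuclideanSpace ℝ (Fin K)) :
    BddBelow ((fun t => ⟪t, g⟫) '' simplexD K) := by
  refine ⟨-∑ j, |g j|, ?_⟩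
  rintro _ ⟨t, ⟨h0, h1⟩, rfl⟩
  have e : ⟪t, g⟫ = ∑ i, t i * g i := by
    simp [PiLp.inner_apply, mul_comm]
  simp only [e]
  rw [← Finset.sum_neg_distrib]
  refine Finset.sum_le_sum fun i _ => ?_
  have hi : t i ≤ 1 := by
    rw [← h1]
    exact Finset.single_le_sum (f := fun i => t i) (fun j _ => h0 j) (Finset.mem_univ i)
  have := h0 i
  have h2 := neg_abs_le (g i)
  have h3 := abs_nonneg (g i)
  nlinarith [mul_nonneg this (by linarith : 0 ≤ g i + |g i|), mul_nonneg h3 (sub_nonneg.2 hi)]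

theorem fw_convex {K : ℕ} (L : EuclideanSpace ℝ (Fin K) → ℝ)
    (g x y : EuclideanSpace ℝ (Fin K)) (hg : HasGradientAt L g x)
    (hconv : ConvexOn ℝ Set.univ L) : L x + ⟪y - x, g⟫ ≤ L y := by
  have hc : ConvexOn ℝ Set.univ (fun t : ℝ => L (AffineMap.lineMap x y t)) := by
    have := hconv.comp_affineMap (AffineMap.lineMap (k := ℝ) x y)
    rw [Set.preimage_univ] at this
    exact this
  have hd : HasDerivAt (fun t : ℝ => L (AffineMap.lineMap x y t)) ⟪y - x, g⟫ 0 := by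
    have h1 : HasDerivAt (fun t : ℝ => (AffineMap.lineMap x y t : EuclideanSpace ℝ (Fin K)))
        (y - x) 0 := AffineMap.hasDerivAt_lineMap
    have h2 : HasFDerivAt L (InnerProductSpace.toDual ℝ _ g)
        ((AffineMap.lineMap x y (0:ℝ) : EuclideanSpace ℝ (Fin K))) := by
      simpa using hg.hasFDerivAt
    have := h2.comp_hasDerivAt (0:ℝ) h1
    simpa [real_inner_comm, Function.comp_def] using this
  have := hc.le_slope_of_hasDerivAt (Set.mem_univ 0) (Set.mem_univ 1) zero_lt_one hd
  simp [slope_def_field] at this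
  linarith

theorem fw_step_mem {K : ℕ} (w s : EuclideanSpace ℝ (Fin K)) (hw : w ∈ simplexD K)
    (hs : s ∈ simplexD K) (γ : ℝ) (h0 : 0 ≤ γ) (h1 : γ ≤ 1) :
    w + γ • (s - w) ∈ simplexD K := by
  refine ⟨fun i => ?_, ?_⟩
  · have a := hw.1 i
    have b := hs.1 i
    simp only [PiLp.add_apply, PiLp.smul_apply, PiLp.sub_apply, smul_eq_mul]
    nlinarith [mul_nonneg h0 b, mul_nonneg (sub_nonneg.2 h1) a]
  · simp only [PiLp.add_apply, PiLp.smul_apply, PiLp.sub_apply, smul_eq_mul,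
      Finset.sum_add_distrib, ← Finset.mul_sum, Finset.sum_sub_distrib, hw.2, hs.2]
    ring

/-- The scalar recursion. -/
theorem fw_scalar (C : ℝ) (hC : 0 ≤ C) (h p : ℕ → ℝ) (hh : ∀ r, 0 ≤ h r)
    (hp : ∀ r, h r ≤ p r)
    (hrec : ∀ r : ℕ, h (r + 1) ≤ h r - 2 / ((r:ℝ) + 2) * p r + (2 / ((r:ℝ) + 2)) ^ 2 / 2 * C)
    (R : ℕ) (hR : 2 ≤ R) :
    ∃ r : ℕ, ⌈(2 / 3 : ℝ) * ((R : ℝ) + 2)⌉₊ - 2 ≤ r ∧ r ≤ R ∧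
      p r ≤ 27 / 4 * C / ((R : ℝ) + 2) := by
  have hprim : ∀ r : ℕ, h (r + 1) ≤ 2 * C / ((r:ℝ) + 3) := by
    intro r
    induction r with
    | zero =>
      have := hrec 0
      have h1 := hp 0
      norm_num at this ⊢
      linarith
    | succ n ih =>
      have h1 := hrec (n + 1)
      have h2 := hp (n + 1)
      push_cast at h1 ⊢
      have hn : (0:ℝ) ≤ n := n.cast_nonneg
      have e : (n:ℝ) + 1 + 2 = n + 3 := by ring
      have e' : (n:ℝ) + 1 + 3 = n + 4 := by ring
      rw [e] at h1
      rw [e']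
      have g0 : 0 ≤ 2 / ((n:ℝ) + 3) := by positivity
      have g1 : 2 / ((n:ℝ) + 3) ≤ 1 := by rw [div_le_one (by positivity)]; linarith
      have h3 : h (n + 1 + 1) ≤ (1 - 2 / ((n:ℝ) + 3)) * (2 * C / ((n:ℝ) + 3))
          + (2 / ((n:ℝ) + 3)) ^ 2 / 2 * C := by
        nlinarith [mul_le_mul_of_nonneg_left h2 g0,
          mul_le_mul_of_nonneg_left ih (sub_nonneg.2 g1)]
      refine h3.trans ?_
      have : (1 - 2 / ((n:ℝ) + 3)) * (2 * C / ((n:ℝ) + 3))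
          + (2 / ((n:ℝ) + 3)) ^ 2 / 2 * C = 2 * C * ((n + 2) / (n + 3) ^ 2) := by
        field_simp
        ring
      rw [this]
      have q : ((n:ℝ) + 2) / (n + 3) ^ 2 ≤ 1 / ((n:ℝ) + 4) := by
        rw [div_le_div_iff₀ (by positivity) (by positivity)]
        nlinarith
      refine (mul_le_mul_of_nonneg_left q (by positivity : 0 ≤ 2 * C)).trans (le_of_eq ?_)
      ring
  by_contra! hcon
  set m := ⌈(2 / 3 : ℝ) * ((R : ℝ) + 2)⌉₊ with hm
  have hRr : (2:ℝ) ≤ R := by exact_mod_cast hR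
  have hD : (0:ℝ) < (R:ℝ) + 2 := by positivity
  have m1 : (2 / 3 : ℝ) * ((R : ℝ) + 2) ≤ m := Nat.le_ceil _
  have m2 : (m:ℝ) < (2 / 3 : ℝ) * ((R : ℝ) + 2) + 1 := Nat.ceil_lt_add_one (by positivity)
  have m3 : 3 ≤ m := by
    have : (2:ℝ) < m := by linarith
    exact_mod_cast this
  obtain ⟨k, hk⟩ : ∃ k, m = k + 3 := ⟨m - 3, by omega⟩
  rw [hk] at m1 m2
  push_cast at m1 m2
  have hkR : k + 1 ≤ R := by
    have : (k:ℝ) + 1 < R + 1 := by linarith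
    have : k + 1 < R + 1 := by exact_mod_cast this
    omega
  have step : ∀ r, k + 1 ≤ r → r ≤ R → h (r + 1) < h r - 9 * C / ((R:ℝ) + 2) ^ 2 := by
    intro r hr1 hr2
    have a := hcon r (by omega) hr2
    have b := hrec r
    have hr1' : (k:ℝ) + 1 ≤ r := by exact_mod_cast hr1
    have hr2' : (r:ℝ) ≤ R := by exact_mod_cast hr2
    have hr0 : (0:ℝ) ≤ r := r.cast_nonneg
    have c1 : 2 / ((r:ℝ) + 2) * (27 / 4 * C / ((R:ℝ) + 2)) < 2 / ((r:ℝ) + 2) * p r :=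
      mul_lt_mul_of_pos_left a (by positivity)
    have c2 : 2 / ((R:ℝ) + 2) * (27 / 4 * C / ((R:ℝ) + 2)) ≤
        2 / ((r:ℝ) + 2) * (27 / 4 * C / ((R:ℝ) + 2)) := by gcongr
    have c3 : 2 / ((r:ℝ) + 2) ≤ 3 / ((R:ℝ) + 2) := by
      rw [div_le_div_iff₀ (by positivity) hD]; linarith
    have c4 : (2 / ((r:ℝ) + 2)) ^ 2 / 2 * C ≤ (3 / ((R:ℝ) + 2)) ^ 2 / 2 * C := by gcongr
    have c5 : 2 / ((R:ℝ) + 2) * (27 / 4 * C / ((R:ℝ) + 2)) - (3 / ((R:ℝ) + 2)) ^ 2 / 2 * C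
        = 9 * C / ((R:ℝ) + 2) ^ 2 := by field_simp; ring
    linarith
  have tot : ∀ j, k + 1 + j ≤ R →
      h (k + 1 + j + 1) < h (k + 1) - (j + 1) * (9 * C / ((R:ℝ) + 2) ^ 2) := by
    intro j
    induction j with
    | zero => intro hj; have := step (k + 1) le_rfl hkR; simpa using this
    | succ j ih =>
      intro hj
      have i1 := ih (by omega)
      have i2 := step (k + 1 + (j + 1)) (by omega) hj
      push_cast
      have : k + 1 + (j + 1) = k + 1 + j + 1 := by ring
      rw [this] at i2 ⊢
      linarith
  obtain ⟨j, hj⟩ : ∃ j, R = k + 1 + j := ⟨R - (k + 1), by omega⟩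
  have t := tot j hj.ge
  have hjr : (R:ℝ) = k + 1 + j := by exact_mod_cast hj
  have u := hprim k
  have v := hh (k + 1 + j + 1)
  have x1 : 2 * C / ((k:ℝ) + 3) ≤ 3 * C / ((R:ℝ) + 2) := by
    rw [div_le_div_iff₀ (by positivity) hD]; nlinarith
  have x2 : ((R:ℝ) + 2) / 3 * (9 * C / ((R:ℝ) + 2) ^ 2) ≤ (j + 1) * (9 * C / ((R:ℝ) + 2) ^ 2) :=
    mul_le_mul_of_nonneg_right (by linarith) (by positivity)
  have x3 : ((R:ℝ) + 2) / 3 * (9 * C / ((R:ℝ) + 2) ^ 2) = 3 * C / ((R:ℝ) + 2) := by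
    field_simp; norm_num
  linarith

theorem stmt6 {K : ℕ} (hK : 1 ≤ K)
    (L : EuclideanSpace ℝ (Fin K) → ℝ)
    (gradL : EuclideanSpace ℝ (Fin K) → EuclideanSpace ℝ (Fin K))
    (hgrad : ∀ x, HasGradientAt L (gradL x) x)
    (hconv : ConvexOn ℝ Set.univ L)
    (Cf : ℝ) (hCf : 0 ≤ Cf)
    (hcurv : ∀ w ∈ simplexD K, ∀ s ∈ simplexD K, ∀ γ ∈ Set.Icc (0:ℝ) 1,
      L (w + γ • (s - w)) ≤ L w + γ * ⟪s - w, gradL w⟫ + γ ^ 2 / 2 * Cf)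
    (wstar : EuclideanSpace ℝ (Fin K)) (hwstar : wstar ∈ simplexD K)
    (hmin : ∀ v ∈ simplexD K, L wstar ≤ L v)
    (δ : ℝ) (hδ : 0 ≤ δ)
    (w s : ℕ → EuclideanSpace ℝ (Fin K))
    (hw0 : w 0 ∈ simplexD K)
    (hsmem : ∀ r : ℕ, s r ∈ simplexD K)
    (hstep : ∀ r : ℕ, w (r + 1) = w r + (2 / ((r : ℝ) + 2)) • (s r - w r))
    (happrox : ∀ r : ℕ, ⟪s r, gradL (w r)⟫ ≤
      sInf ((fun t => ⟪t, gradL (w r)⟫) '' simplexD K) + 1 / 2 * δ * (2 / ((r : ℝ) + 2)) * Cf)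
    (R : ℕ) (hR : 2 ≤ R) :
    ∃ r : ℕ, ⌈(2 / 3 : ℝ) * ((R : ℝ) + 2)⌉₊ - 2 ≤ r ∧ r ≤ R ∧
      dualGap gradL (w r) ≤ 27 / 4 * Cf * (1 + δ) / ((R : ℝ) + 2) := by
  have hγ0 : ∀ r : ℕ, 0 ≤ 2 / ((r:ℝ) + 2) := fun r => by positivity
  have hγ1 : ∀ r : ℕ, 2 / ((r:ℝ) + 2) ≤ 1 := fun r => by
    have : (0:ℝ) ≤ r := r.cast_nonneg
    rw [div_le_one (by positivity)]; linarith
  have hw : ∀ r, w r ∈ simplexD K := by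
    intro r
    induction r with
    | zero => exact hw0
    | succ n ih =>
      rw [hstep]
      exact fw_step_mem _ _ ih (hsmem n) _ (hγ0 n) (hγ1 n)
  obtain ⟨r, h1, h2, h3⟩ := fw_scalar (Cf * (1 + δ)) (by positivity)
    (fun r => L (w r) - L wstar)
    (fun r => ⟪w r, gradL (w r)⟫ - sInf ((fun t => ⟪t, gradL (w r)⟫) '' simplexD K))
    (fun r => sub_nonneg.2 (hmin _ (hw r)))
    (fun r => by
      have a := fw_convex L _ _ wstar (hgrad (w r)) hconv
      have b := csInf_le (fw_bdd (gradL (w r))) (Set.mem_image_of_mem _ hwstar)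
      rw [inner_sub_left] at a
      beta_reduce at b ⊢
      linarith)
    (fun r => by
      have a := hcurv _ (hw r) _ (hsmem r) _ ⟨hγ0 r, hγ1 r⟩
      have b := mul_le_mul_of_nonneg_left (happrox r) (hγ0 r)
      rw [← hstep, inner_sub_left] at a
      beta_reduce
      linarith)
    R hR
  refine ⟨r, h1, h2, le_trans ?_ (h3.trans (le_of_eq (by ring)))⟩
  refine csSup_le (Set.Nonempty.image _ ⟨wstar, hwstar⟩) ?_
  rintro _ ⟨t, ht, rfl⟩
  have b := csInf_le (fw_bdd (gradL (w r))) (Set.mem_image_of_mem _ ht)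
  simp only [inner_sub_left] at b ⊢
  linarith
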